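/- Assume $\mathcal S$ is primitive, let $\bar a\in\Sigma$, let $x'\in\mathcal P(X_{\bar a})$ be a finite patch, and let $(H_n)$ be a Van Hove sequence of bounded measurable subsets of $\mathbb R^d$ with positive Lebesgue measure. For each $\bar b\in\Sigma$ choose a hierarchical tiling $x_{\bar b}\in X_{\bar b}$ and let $L^{\bar b}_{x'}(H)$ be the number of translates of $x'$ contained in $x_{\bar b}$ with support contained in $H$. Then there is a neighborhood $U$ of $\bar a$ in $(\Sigma,d_\Sigma)$ such that the functions $\bar b\mapsto L^{\bar b}_{x'}(H_n)/\operatorname{vol}(H_n)$ converge, as $n\to\infty$, uniformly on $U$ to $\bar b\mapsto c_{\bar b}(x')$, where $c_{\bar b}(x')=\lim_m L_{x'}(S^m_{\bar b}(D_j))/\operatorname{vol}(S^m_{\bar b}(D_j))$. -/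

import Mathlib

open Filter Topology Set Metric MeasureTheory

noncomputable section

/-- Points of `ℝ^d`. -/
abbrev Pt (d : ℕ) := EuclideanSpace ℝ (Fin d)

/-- A patch is a collection of subsets of `ℝ^d` (intended: tiles with disjoint interiors). -/
abbrev Patch (d : ℕ) := Set (Set (Pt d))

/-- Translation of a single tile. -/
def tileTrans {d : ℕ} (t : Pt d) (D : Set (Pt d)) : Set (Pt d) := (fun p => t + p) '' D

/-- Translation of a patch, `t + x`. -/
def patchTrans {d : ℕ} (t : Pt d) (x : Patch d) : Patch d := tileTrans t '' x

/-- A tile: compact, connected, and the closure of its interior. -/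
def IsTile {d : ℕ} (D : Set (Pt d)) : Prop :=
  IsCompact D ∧ IsConnected D ∧ D = closure (interior D)

/-- A patch: a collection of tiles with pairwise disjoint interiors. -/
def IsPatch {d : ℕ} (x : Patch d) : Prop :=
  (∀ D ∈ x, IsTile D) ∧
  ∀ D ∈ x, ∀ D' ∈ x, D ≠ D' → interior D ∩ interior D' = ∅

/-- The support of a patch: the union of its tiles. -/
def psupp {d : ℕ} (x : Patch d) : Set (Pt d) := ⋃ D ∈ x, D

/-- A tiling of `ℝ^d`: a patch whose support is all of `ℝ^d`. -/
def IsTiling {d : ℕ} (x : Patch d) : Prop := IsPatch x ∧ psupp x = univ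

/-- The tiles occurring in tilings of `X`. -/
def TilesOf {d : ℕ} (X : Set (Patch d)) : Set (Set (Pt d)) := {D | ∃ x ∈ X, D ∈ x}

/-- `𝒫(X)`: the finite patches contained in tilings of `X`. -/
def Patches {d : ℕ} (X : Set (Patch d)) : Set (Patch d) :=
  {x' | x'.Finite ∧ ∃ x ∈ X, x' ⊆ x}

/-- `𝒫^N(X)`: the patches with `N` tiles contained in tilings of `X`. -/
def PatchesCard {d : ℕ} (X : Set (Patch d)) (N : ℕ) : Set (Patch d) :=
  {x' | x'.Finite ∧ x'.ncard = N ∧ ∃ x ∈ X, x' ⊆ x}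

/-- `X` is invariant under the translation action. -/
def TransInvariant {d : ℕ} (X : Set (Patch d)) : Prop :=
  ∀ t : Pt d, ∀ x ∈ X, patchTrans t x ∈ X

/-- Finite local complexity: for each `N` there are only finitely many `N`-tile patches
in tilings of `X` up to translation. -/
def FLC {d : ℕ} (X : Set (Patch d)) : Prop :=
  ∀ N : ℕ, ∃ F : Finset (Patch d),
    ∀ x' ∈ PatchesCard X N, ∃ y ∈ F, ∃ t : Pt d, patchTrans t y = x'

/-- The tiling metric `d_T`. -/
def dT {d : ℕ} (x y : Patch d) : ℝ :=
  sInf ({Real.sqrt 2 / 2} ∪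
    {r : ℝ | 0 < r ∧ r < Real.sqrt 2 / 2 ∧
      ∃ x' ⊆ x, ∃ y' ⊆ y,
        Bornology.IsBounded (psupp x') ∧ Bornology.IsBounded (psupp y') ∧
        closedBall (0 : Pt d) (1 / r) ⊆ psupp x' ∧
        closedBall (0 : Pt d) (1 / r) ⊆ psupp y' ∧
        ∃ t : Pt d, ‖t‖ ≤ r ∧ patchTrans t x' = y'})

/-- A (self-similar) substitution on the tiles of `X`, with dilatation factor `lam`,
extended tile-by-tile to patches, mapping finite patches of `X` to finite patches of `X`
and tilings of `X` to tilings of `X`. -/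
structure Substitution (d : ℕ) (X : Set (Patch d)) where
  map : Set (Pt d) → Patch d
  lam : ℝ
  one_lt_lam : 1 < lam
  supp_eq : ∀ D ∈ TilesOf X, psupp (map D) = (fun p => lam • p) '' D
  equivar : ∀ (t : Pt d) (D : Set (Pt d)), map (tileTrans t D) = patchTrans (lam • t) (map D)
  maps_patches : ∀ x' ∈ Patches X, (⋃ D ∈ x', map D) ∈ Patches X
  maps_X : ∀ x ∈ X, (⋃ D ∈ x, map D) ∈ X

/-- A substitution applied to a patch, tile by tile. -/
def substPatch {d : ℕ} {X : Set (Patch d)} (S : Substitution d X) (x : Patch d) : Patch d :=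
  ⋃ D ∈ x, S.map D

/-- The structure matrix of a substitution with respect to prototiles `Dp`:
entry `(i,j)` is the number of tiles equivalent (translation-equal) to `Dp i` in `S (Dp j)`. -/
def structMat {d l : ℕ} {X : Set (Patch d)} (Dp : Fin l → Set (Pt d)) (S : Substitution d X) :
    Matrix (Fin l) (Fin l) ℕ :=
  fun i j => {D | D ∈ S.map (Dp j) ∧ ∃ t : Pt d, D = tileTrans t (Dp i)}.ncard

/-- `Dp` is a complete family of pairwise non-equivalent prototiles of `X`. -/
def IsPrototileBasis {d l : ℕ} (X : Set (Patch d)) (Dp : Fin l → Set (Pt d)) : Prop :=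
  (∀ i, Dp i ∈ TilesOf X) ∧
  (∀ i j, i ≠ j → ∀ t : Pt d, tileTrans t (Dp i) ≠ Dp j) ∧
  ∀ D ∈ TilesOf X, ∃ i, ∃ t : Pt d, tileTrans t (Dp i) = D

/-- `S^n_ā = S_{a_1} ∘ S_{a_2} ∘ ⋯ ∘ S_{a_n}` acting on patches (`a 0` plays the role
of `a_1`). -/
def substSeq {d k : ℕ} {X : Set (Patch d)} (S : Fin k → Substitution d X) :
    (ℕ → Fin k) → ℕ → Patch d → Patch d
  | _, 0 => id
  | a, n + 1 => fun x => substPatch (S (a 0)) (substSeq S (fun i => a (i + 1)) n x)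

/-- `A^n_ā = A_{a_1} A_{a_2} ⋯ A_{a_n}`. -/
def matSeq {l k : ℕ} (A : Fin k → Matrix (Fin l) (Fin l) ℕ) :
    (ℕ → Fin k) → ℕ → Matrix (Fin l) (Fin l) ℕ
  | _, 0 => 1
  | a, n + 1 => A (a 0) * matSeq A (fun i => a (i + 1)) n

/-- Primitivity of the sequence of structure matrices `(A_{a_n})`: for every `n` some
product `A_{a_n} A_{a_{n+1}} ⋯ A_{a_{n+N}}` has all entries positive. -/
def SeqPrimitive {l k : ℕ} (A : Fin k → Matrix (Fin l) (Fin l) ℕ) (a : ℕ → Fin k) : Prop :=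
  ∀ n : ℕ, ∃ N : ℕ, ∀ p q : Fin l, 0 < matSeq A (fun m => a (n + m)) (N + 1) p q

/-- The multi-substitution tiling space `X_ā` (with initial tile `D`). -/
def multiSpace {d k : ℕ} {X : Set (Patch d)} (S : Fin k → Substitution d X) (a : ℕ → Fin k)
    (D : Set (Pt d)) : Set (Patch d) :=
  {x | x ∈ X ∧ ∀ x' ⊆ x, x'.Finite →
    ∃ n : ℕ, 0 < n ∧ ∃ t : Pt d, patchTrans t x' ⊆ substSeq S a n {D}}

/-- The substitution tiling space of a single substitution, given by its action
`F` on patches (with initial tile `D`). -/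
def substSpaceF {d : ℕ} (X : Set (Patch d)) (F : Patch d → Patch d) (D : Set (Pt d)) :
    Set (Patch d) :=
  {x | x ∈ X ∧ ∀ x' ⊆ x, x'.Finite →
    ∃ m : ℕ, 0 < m ∧ ∃ t : Pt d, patchTrans t x' ⊆ F^[m] {D}}

open Classical in
/-- The metric on `Σ = {1,…,k}^ℕ`: `d(ā,b̄) = 1/L` where `L` is the least (1-indexed)
position where the sequences differ, and `0` if they are equal. -/
def dSigma {k : ℕ} (a b : ℕ → Fin k) : ℝ :=
  if h : ∃ n, a n ≠ b n then 1 / ((Nat.find h : ℝ) + 1) else 0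

/-- The shift `σ` on `Σ`. -/
def seqShift {k : ℕ} (a : ℕ → Fin k) : ℕ → Fin k := fun n => a (n + 1)

/-- A substitution is recognizable if it is injective on `X`. -/
def Recognizable {d : ℕ} {X : Set (Patch d)} (S : Substitution d X) : Prop :=
  ∀ x ∈ X, ∀ y ∈ X, substPatch S x = substPatch S y → x = y

/-- A substitution is strongly recognizable if it is recognizable and `S(D') ⊆ S(x)`
implies `D' ∈ x` for every tiling `x ∈ X` and tile `D'`. -/
def StronglyRecognizable {d : ℕ} {X : Set (Patch d)} (S : Substitution d X) : Prop :=
  Recognizable S ∧ ∀ x ∈ X, ∀ D' ∈ TilesOf X, S.map D' ⊆ substPatch S x → D' ∈ x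

/-- `L_{x'}(y')`: the number of translated copies of `x'` contained in `y'`. -/
def Lcount {d : ℕ} (x' y' : Patch d) : ℕ := {t : Pt d | patchTrans t x' ⊆ y'}.ncard

/-- The Euclidean volume of the support of a patch. -/
def pvol {d : ℕ} (y' : Patch d) : ℝ := (volume (psupp y')).toReal

/-- `L^x_{x'}(H)`: the number of translated copies of `x'` contained in `x` whose support
is contained in `H`. -/
def LcountIn {d : ℕ} (x x' : Patch d) (H : Set (Pt d)) : ℕ :=
  {t : Pt d | patchTrans t x' ⊆ x ∧ psupp (patchTrans t x') ⊆ H}.ncard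

/-- `H^{+r}`: the set of points at distance at most `r` from `H`. -/
def plusR {d : ℕ} (H : Set (Pt d)) (r : ℝ) : Set (Pt d) := {t | ∃ h ∈ H, dist t h ≤ r}

/-- Van Hove sequence of subsets of `ℝ^d`. -/
def VanHove {d : ℕ} (H : ℕ → Set (Pt d)) : Prop :=
  ∀ r : ℝ, 0 ≤ r →
    Tendsto (fun n => (volume (plusR (frontier (H n)) r)).toReal / (volume (H n)).toReal)
      atTop (nhds 0)

/-- A tiling of `X_ā` which is an increasing union of translates of the supertiles
`S^{k_n}_ā(D)`. -/
def Hierarchical {d k : ℕ} {X : Set (Patch d)} (S : Fin k → Substitution d X) (a : ℕ → Fin k)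
    (x : Patch d) : Prop :=
  ∃ (kn : ℕ → ℕ) (tn : ℕ → Pt d) (D : Set (Pt d)), D ∈ TilesOf X ∧
    Tendsto kn atTop atTop ∧
    (∀ n, patchTrans (tn n) (substSeq S a (kn n) {D}) ⊆
      patchTrans (tn (n + 1)) (substSeq S a (kn (n + 1)) {D})) ∧
    x = ⋃ n, patchTrans (tn n) (substSeq S a (kn n) {D})

/-- The topology on the space of patches generated by the `d_T`-balls. -/
def tilingTopology (d : ℕ) : TopologicalSpace (Patch d) :=
  TopologicalSpace.generateFrom {U | ∃ (x : Patch d) (r : ℝ), 0 < r ∧ U = {y | dT x y < r}}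

/-- The Borel σ-algebra associated to the tiling topology. -/
def tilingMeasurable (d : ℕ) : MeasurableSpace (Patch d) :=
  @borel (Patch d) (tilingTopology d)

/-- A Borel probability measure concentrated on `Y` and invariant under the translation
action. -/
def GoodMeasure {d : ℕ} (Y : Set (Patch d))
    (μ : @MeasureTheory.Measure (Patch d) (tilingMeasurable d)) : Prop :=
  letI := tilingMeasurable d
  μ Set.univ = 1 ∧ μ Yᶜ = 0 ∧
    ∀ (t : Pt d) (s : Set (Patch d)), μ (patchTrans t ⁻¹' s) = μ s

/-- `ν` is the pushforward of `μ` under `F`. -/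
def PushForwardEq {d : ℕ} (F : Patch d → Patch d)
    (μ ν : @MeasureTheory.Measure (Patch d) (tilingMeasurable d)) : Prop :=
  letI := tilingMeasurable d
  ∀ s : Set (Patch d), μ (F ⁻¹' s) = ν s


/-! ### Basic translation and scaling facts -/

lemma tileTrans_add {d : ℕ} (s t : Pt d) (A : Set (Pt d)) :
    tileTrans s (tileTrans t A) = tileTrans (s + t) A := by
  unfold tileTrans
  rw [image_image]
  simp only [add_assoc]

lemma tileTrans_zero {d : ℕ} (A : Set (Pt d)) : tileTrans 0 A = A := by
  unfold tileTrans
  simp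

lemma tileTrans_inj {d : ℕ} (t : Pt d) : Function.Injective (tileTrans t) := by
  intro A B h
  have := congrArg (tileTrans (-t)) h
  simpa [tileTrans_add, tileTrans_zero] using this

lemma tileTrans_homeo {d : ℕ} (t : Pt d) (A : Set (Pt d)) :
    tileTrans t A = (Homeomorph.addLeft t) '' A := rfl

lemma interior_tileTrans {d : ℕ} (t : Pt d) (A : Set (Pt d)) :
    interior (tileTrans t A) = tileTrans t (interior A) := by
  rw [tileTrans_homeo, tileTrans_homeo, Homeomorph.image_interior]

lemma frontier_tileTrans {d : ℕ} (t : Pt d) (A : Set (Pt d)) :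
    frontier (tileTrans t A) = tileTrans t (frontier A) := by
  rw [tileTrans_homeo, tileTrans_homeo, Homeomorph.image_frontier]

lemma vol_tileTrans {d : ℕ} (t : Pt d) (A : Set (Pt d)) :
    volume.real (tileTrans t A) = volume.real A := by
  unfold tileTrans
  rw [image_add_left, measureReal_def, measure_preimage_add, measureReal_def]

lemma patchTrans_add {d : ℕ} (s t : Pt d) (x : Patch d) :
    patchTrans s (patchTrans t x) = patchTrans (s + t) x := by
  unfold patchTrans
  rw [image_image]
  simp only [tileTrans_add]

lemma patchTrans_zero {d : ℕ} (x : Patch d) : patchTrans 0 x = x := by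
  unfold patchTrans
  have : (tileTrans (0 : Pt d)) = id := by
    funext A; exact tileTrans_zero A
  rw [this, image_id]

lemma psupp_patchTrans {d : ℕ} (t : Pt d) (x : Patch d) :
    psupp (patchTrans t x) = tileTrans t (psupp x) := by
  unfold psupp patchTrans
  rw [biUnion_image]
  unfold tileTrans
  rw [image_iUnion₂]

/-- Scaling of a set. -/
def scl {d : ℕ} (c : ℝ) (A : Set (Pt d)) : Set (Pt d) := (fun p => c • p) '' A

lemma scl_scl {d : ℕ} (c e : ℝ) (A : Set (Pt d)) : scl c (scl e A) = scl (c * e) A := by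
  unfold scl
  rw [image_image]
  simp only [smul_smul]

lemma scl_one {d : ℕ} (A : Set (Pt d)) : scl 1 A = A := by
  unfold scl
  simp

lemma scl_homeo {d : ℕ} {c : ℝ} (hc : 0 < c) (A : Set (Pt d)) :
    scl c A = (Homeomorph.smulOfNeZero c hc.ne') '' A := rfl

lemma interior_scl {d : ℕ} {c : ℝ} (hc : 0 < c) (A : Set (Pt d)) :
    interior (scl c A) = scl c (interior A) := by
  rw [scl_homeo hc, scl_homeo hc, Homeomorph.image_interior]

lemma closure_scl {d : ℕ} {c : ℝ} (hc : 0 < c) (A : Set (Pt d)) :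
    closure (scl c A) = scl c (closure A) := by
  rw [scl_homeo hc, scl_homeo hc, Homeomorph.image_closure]

lemma frontier_scl {d : ℕ} {c : ℝ} (hc : 0 < c) (A : Set (Pt d)) :
    frontier (scl c A) = scl c (frontier A) := by
  rw [scl_homeo hc, scl_homeo hc, Homeomorph.image_frontier]

lemma scl_tileTrans {d : ℕ} (c : ℝ) (t : Pt d) (A : Set (Pt d)) :
    scl c (tileTrans t A) = tileTrans (c • t) (scl c A) := by
  unfold scl tileTrans
  rw [image_image, image_image]
  simp only [smul_add]

open Pointwise in
lemma vol_scl {d : ℕ} {c : ℝ} (hc : 0 < c) (A : Set (Pt d)) :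
    volume.real (scl c A) = c ^ d * volume.real A := by
  have : scl c A = c • A := rfl
  rw [this, measureReal_def, Measure.addHaar_smul, ENNReal.toReal_mul, measureReal_def]
  rw [ENNReal.toReal_ofReal (abs_nonneg _), abs_of_nonneg (by positivity)]
  simp

lemma scl_isTile {d : ℕ} {c : ℝ} (hc : 0 < c) {A : Set (Pt d)} (hA : IsTile A) :
    IsTile (scl c A) := by
  refine ⟨?_, ?_, ?_⟩
  · exact hA.1.image (by fun_prop)
  · exact hA.2.1.image _ (by fun_prop)
  · rw [interior_scl hc, closure_scl hc, ← hA.2.2]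

lemma IsTile.int_ne {d : ℕ} {A : Set (Pt d)} (hA : IsTile A) : (interior A).Nonempty := by
  rw [← closure_nonempty_iff, ← hA.2.2]
  exact hA.2.1.nonempty

lemma IsTile.vol_ne_top {d : ℕ} {A : Set (Pt d)} (hA : IsTile A) : volume A ≠ ⊤ :=
  hA.1.measure_lt_top.ne

lemma IsTile.int_vol_pos {d : ℕ} {A : Set (Pt d)} (hA : IsTile A) :
    0 < volume.real (interior A) := by
  rw [measureReal_def]
  refine ENNReal.toReal_pos ?_ ?_
  · exact (isOpen_interior.measure_pos _ hA.int_ne).ne'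
  · exact ((measure_mono interior_subset).trans_lt hA.1.measure_lt_top).ne

lemma IsTile.vol_pos {d : ℕ} {A : Set (Pt d)} (hA : IsTile A) :
    0 < volume.real A :=
  hA.int_vol_pos.trans_le (measureReal_mono interior_subset hA.vol_ne_top)

/-- The interior of a tile does not meet another tile with disjoint interior. -/
lemma int_disj_tile {d : ℕ} {A B : Set (Pt d)} (hB : IsTile B)
    (h : interior A ∩ interior B = ∅) : interior A ∩ B = ∅ := by
  rw [hB.2.2]
  exact ((disjoint_iff_inter_eq_empty.2 h).closure_right isOpen_interior).inter_eq

lemma exists_frontier {d : ℕ} {A : Set (Pt d)} {p q : Pt d} (hp : p ∈ A) (hq : q ∉ A) :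
    ∃ z ∈ frontier A, dist p z ≤ dist p q := by
  by_contra! hcon
  have hseg : ∀ z ∈ segment ℝ p q, z ∉ frontier A := by
    intro z hz hzA
    have h1 := hcon z hzA
    have h2 : dist p z + dist z q = dist p q := dist_add_dist_of_mem_segment hz
    have := dist_nonneg (x := z) (y := q)
    linarith
  have hpre : IsPreconnected (segment ℝ p q) := (convex_segment p q).isPreconnected
  have := isPreconnected_iff_subset_of_disjoint.1 hpre (interior A) (closure A)ᶜ isOpen_interior
    isClosed_closure.isOpen_compl (by
      intro z hz
      by_cases h : z ∈ interior A
      · exact Or.inl h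
      · right
        intro h2
        exact hseg z hz ⟨h2, h⟩) (by
      ext z
      simp only [mem_inter_iff, mem_compl_iff, mem_empty_iff_false, iff_false, not_and, not_not]
      intro _ h
      exact subset_closure (interior_subset h))
  rcases this with h | h
  · exact hq (interior_subset (h (right_mem_segment ℝ p q)))
  · exact h (left_mem_segment ℝ p q) (subset_closure hp)

lemma tileTrans_left_inj {d : ℕ} {P : Set (Pt d)} (hP : IsTile P) {s t : Pt d}
    (h : tileTrans s P = tileTrans t P) : s = t := by
  obtain ⟨p, hpP, hp⟩ := hP.1.exists_isMaxOn hP.2.1.nonempty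
    (f := fun y => inner ℝ (s - t) y) (by fun_prop)
  have : s + p ∈ tileTrans t P := by rw [← h]; exact ⟨p, hpP, rfl⟩
  obtain ⟨q, hqP, hq⟩ := this
  have h1 : inner ℝ (s - t) q ≤ inner ℝ (s - t) p := hp hqP
  have h2 : q = (s - t) + p := by
    simp only at hq
    rw [sub_add_eq_add_sub, ← hq]; abel
  rw [h2, inner_add_right] at h1
  have h3 : inner ℝ (s - t) (s - t) ≤ (0 : ℝ) := by linarith
  rw [real_inner_self_nonpos] at h3
  exact sub_eq_zero.1 h3

/-- Volume bound on the number of translates of a tile. -/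
lemma count_le {d : ℕ} {x : Patch d} (hx : IsPatch x) {P : Set (Pt d)} (hP : IsTile P)
    {B : Set (Pt d)} (hB : volume B ≠ ⊤) {E : Set (Pt d)}
    (hE : ∀ t ∈ E, tileTrans t P ∈ x ∧ tileTrans t P ⊆ B) :
    E.Finite ∧ (E.ncard : ℝ) * volume.real (interior P) ≤ volume.real B := by
  have key : ∀ F : Finset (Pt d), (F : Set (Pt d)) ⊆ E →
      (F.card : ℝ) * volume.real (interior P) ≤ volume.real B := by
    intro F hF
    have hsum : volume.real (⋃ t ∈ F, interior (tileTrans t P))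
        = ∑ t ∈ F, volume.real (interior (tileTrans t P)) := by
      apply measureReal_biUnion_finset
      · intro s hs t ht hst
        refine disjoint_iff_inter_eq_empty.2 (hx.2 _ (hE s (hF hs)).1 _ (hE t (hF ht)).1 ?_)
        intro h
        exact hst (tileTrans_left_inj hP h)
      · intro t _
        exact isOpen_interior.measurableSet
      · intro t ht
        exact ((measure_mono (interior_subset.trans (hE t (hF ht)).2)).trans_lt hB.lt_top).ne
    have h2 : ∑ t ∈ F, volume.real (interior (tileTrans t P))
        = (F.card : ℝ) * volume.real (interior P) := by
      simp only [interior_tileTrans, vol_tileTrans]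
      simp
    rw [← h2, ← hsum]
    apply measureReal_mono _ hB
    exact iUnion₂_subset fun t ht => interior_subset.trans (hE t (hF ht)).2
  have hu := hP.int_vol_pos
  have hfin : E.Finite := by
    by_contra hinf
    obtain ⟨n, hn⟩ := exists_nat_gt (volume.real B / volume.real (interior P))
    obtain ⟨F, hF, hc⟩ := Set.Infinite.exists_subset_card_eq hinf n
    have := key F hF
    rw [hc] at this
    rw [div_lt_iff₀ hu] at hn
    linarith
  refine ⟨hfin, ?_⟩
  rw [Set.ncard_eq_toFinset_card E hfin]
  exact key _ (by simp)

/-! ### Substitution sequences -/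

/-- Total dilatation factor. -/
def Lam {d k : ℕ} {X : Set (Patch d)} (S : Fin k → Substitution d X) : (ℕ → Fin k) → ℕ → ℝ
  | _, 0 => 1
  | a, n + 1 => (S (a 0)).lam * Lam S (fun i => a (i + 1)) n

lemma Lam_pos {d k : ℕ} {X : Set (Patch d)} (S : Fin k → Substitution d X) (m : ℕ) :
    ∀ b : ℕ → Fin k, 0 < Lam S b m := by
  induction m with
  | zero => intro b; simp [Lam]
  | succ m ih =>
    intro b
    exact mul_pos (by linarith [(S (b 0)).one_lt_lam]) (ih _)

lemma Lam_ge {d k : ℕ} (hk : 0 < k) {X : Set (Patch d)} (S : Fin k → Substitution d X) :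
    ∃ κ : ℝ, 1 < κ ∧ ∀ (m : ℕ) (b : ℕ → Fin k), κ ^ m ≤ Lam S b m := by
  have : Nonempty (Fin k) := ⟨⟨0, hk⟩⟩
  obtain ⟨i, hi⟩ := Finite.exists_min (fun i => (S i).lam)
  refine ⟨(S i).lam, (S i).one_lt_lam, fun m => ?_⟩
  have h0 : 0 < (S i).lam := by linarith [(S i).one_lt_lam]
  induction m with
  | zero => intro b; simp [Lam]
  | succ m ih =>
    intro b
    rw [pow_succ']
    exact mul_le_mul (hi _) (ih _) (by positivity) (h0.le.trans (hi _))

lemma substPatch_union {d : ℕ} {X : Set (Patch d)} (S : Substitution d X) (x : Patch d) :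
    substPatch S x = ⋃ T ∈ x, substPatch S {T} := by
  simp [substPatch]

lemma substSeq_union {d k : ℕ} {X : Set (Patch d)} (S : Fin k → Substitution d X) (m : ℕ)
    (x : Patch d) : ∀ b : ℕ → Fin k, substSeq S b m x = ⋃ T ∈ x, substSeq S b m {T} := by
  induction m with
  | zero => intro b; simp [substSeq]
  | succ m ih =>
    intro b
    simp only [substSeq]
    rw [ih]
    simp only [substPatch, biUnion_iUnion]

lemma mem_substSeq {d k : ℕ} {X : Set (Patch d)} (S : Fin k → Substitution d X) (m : ℕ)
    (x : Patch d) (b : ℕ → Fin k) (P : Set (Pt d)) :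
    P ∈ substSeq S b m x ↔ ∃ T ∈ x, P ∈ substSeq S b m {T} := by
  rw [substSeq_union]; simp

lemma substSeq_mono {d k : ℕ} {X : Set (Patch d)} (S : Fin k → Substitution d X) (m : ℕ)
    {x y : Patch d} (h : x ⊆ y) (b : ℕ → Fin k) : substSeq S b m x ⊆ substSeq S b m y := by
  rw [substSeq_union, substSeq_union S m y]
  exact biUnion_subset_biUnion_left h

lemma substSeq_X {d k : ℕ} {X : Set (Patch d)} (S : Fin k → Substitution d X) (m : ℕ)
    {x : Patch d} (hx : x ∈ X) : ∀ b : ℕ → Fin k, substSeq S b m x ∈ X := by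
  induction m with
  | zero => intro b; simpa [substSeq] using hx
  | succ m ih => intro b; exact (S (b 0)).maps_X _ (ih _)

lemma substSeq_Patches {d k : ℕ} {X : Set (Patch d)} (S : Fin k → Substitution d X) (m : ℕ)
    {x : Patch d} (hx : x ∈ Patches X) : ∀ b : ℕ → Fin k, substSeq S b m x ∈ Patches X := by
  induction m with
  | zero => intro b; simpa [substSeq] using hx
  | succ m ih => intro b; exact (S (b 0)).maps_patches _ (ih _)

lemma substSeq_add {d k : ℕ} {X : Set (Patch d)} (S : Fin k → Substitution d X) (m n : ℕ)
    (x : Patch d) : ∀ b : ℕ → Fin k,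
    substSeq S b (m + n) x = substSeq S b m (substSeq S (fun i => b (i + m)) n x) := by
  induction m with
  | zero => intro b; simp [substSeq]
  | succ m ih =>
    intro b
    rw [Nat.succ_add]
    simp only [substSeq]
    rw [ih]
    rfl

lemma substSeq_congr {d k : ℕ} {X : Set (Patch d)} (S : Fin k → Substitution d X) (m : ℕ)
    (x : Patch d) : ∀ b b' : ℕ → Fin k, (∀ i < m, b i = b' i) →
    substSeq S b m x = substSeq S b' m x := by
  induction m with
  | zero => intro b b' _; simp [substSeq]
  | succ m ih =>
    intro b b' h
    simp only [substSeq]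
    rw [ih _ (fun i => b' (i + 1)) (fun i hi => h _ (by omega)), h 0 (by omega)]

lemma Lam_congr {d k : ℕ} {X : Set (Patch d)} (S : Fin k → Substitution d X) (m : ℕ) :
    ∀ b b' : ℕ → Fin k, (∀ i < m, b i = b' i) → Lam S b m = Lam S b' m := by
  induction m with
  | zero => intro b b' _; simp [Lam]
  | succ m ih =>
    intro b b' h
    simp only [Lam]
    rw [ih _ (fun i => b' (i + 1)) (fun i hi => h _ (by omega)), h 0 (by omega)]

lemma substPatch_trans {d : ℕ} {X : Set (Patch d)} (S : Substitution d X) (t : Pt d)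
    (x : Patch d) : substPatch S (patchTrans t x) = patchTrans (S.lam • t) (substPatch S x) := by
  unfold substPatch
  rw [patchTrans, biUnion_image]
  simp only [S.equivar]
  unfold patchTrans
  rw [image_iUnion₂]

lemma substSeq_trans {d k : ℕ} {X : Set (Patch d)} (S : Fin k → Substitution d X) (m : ℕ)
    (t : Pt d) (x : Patch d) : ∀ b : ℕ → Fin k,
    substSeq S b m (patchTrans t x) = patchTrans (Lam S b m • t) (substSeq S b m x) := by
  induction m with
  | zero => intro b; simp [substSeq, Lam]
  | succ m ih =>
    intro b
    simp only [substSeq, Lam]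
    rw [ih, substPatch_trans, smul_smul]

lemma psupp_substPatch {d : ℕ} {X : Set (Patch d)} (S : Substitution d X) (x : Patch d)
    (hx : ∀ T ∈ x, T ∈ TilesOf X) : psupp (substPatch S x) = scl S.lam (psupp x) := by
  have h1 : psupp (substPatch S x) = ⋃ T ∈ x, psupp (S.map T) := by
    simp only [psupp, substPatch, biUnion_iUnion]
  rw [h1]
  unfold scl psupp
  rw [image_iUnion₂]
  exact iUnion₂_congr fun T hT => S.supp_eq T (hx T hT)

lemma Patches_tiles {d : ℕ} {X : Set (Patch d)} {x : Patch d} (hx : x ∈ Patches X) :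
    ∀ T ∈ x, T ∈ TilesOf X := by
  obtain ⟨_, y, hy, hxy⟩ := hx
  exact fun T hT => ⟨y, hy, hxy hT⟩

lemma single_Patches {d : ℕ} {X : Set (Patch d)} {T : Set (Pt d)} (hT : T ∈ TilesOf X) :
    ({T} : Patch d) ∈ Patches X := by
  obtain ⟨y, hy, hTy⟩ := hT
  exact ⟨finite_singleton _, y, hy, by simpa using hTy⟩

lemma psupp_substSeq {d k : ℕ} {X : Set (Patch d)} (S : Fin k → Substitution d X) (m : ℕ)
    {x : Patch d} (hx : x ∈ Patches X) : ∀ b : ℕ → Fin k,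
    psupp (substSeq S b m x) = scl (Lam S b m) (psupp x) := by
  induction m with
  | zero => intro b; simp [substSeq, Lam, scl_one]
  | succ m ih =>
    intro b
    simp only [substSeq, Lam]
    rw [psupp_substPatch _ _ (Patches_tiles (substSeq_Patches S m hx _)), ih, scl_scl]

lemma psupp_super {d k : ℕ} {X : Set (Patch d)} (S : Fin k → Substitution d X) (m : ℕ)
    {T : Set (Pt d)} (hT : T ∈ TilesOf X) (b : ℕ → Fin k) :
    psupp (substSeq S b m {T}) = scl (Lam S b m) T := by
  rw [psupp_substSeq S m (single_Patches hT)]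
  simp [psupp]

lemma TilesOf_isTile {d : ℕ} {X : Set (Patch d)} (hX : ∀ x ∈ X, IsTiling x) {T : Set (Pt d)}
    (hT : T ∈ TilesOf X) : IsTile T := by
  obtain ⟨x, hx, hTx⟩ := hT
  exact (hX x hx).1.1 T hTx

lemma mem_psupp_sub {d : ℕ} {x : Patch d} {P : Set (Pt d)} (hP : P ∈ x) : P ⊆ psupp x :=
  subset_biUnion_of_mem (u := fun P => P) hP

/-- Distinct supertiles have disjoint interiors. -/
lemma super_int_disj {d : ℕ} {c : ℝ} (hc : 0 < c) {x : Patch d} (hx : IsPatch x)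
    {T T' : Set (Pt d)} (hT : T ∈ x) (hT' : T' ∈ x) (hne : T ≠ T') :
    interior (scl c T) ∩ interior (scl c T') = ∅ := by
  rw [interior_scl hc, interior_scl hc, scl_homeo hc, scl_homeo hc,
    ← image_inter (Homeomorph.injective _), hx.2 T hT T' hT' hne, image_empty]

/-- Distinct supertiles share no tile; moreover the interior of a tile in one
does not meet the support of the other. -/
lemma super_disj {d k : ℕ} {X : Set (Patch d)} (hX : ∀ x ∈ X, IsTiling x)
    (S : Fin k → Substitution d X) (m : ℕ) (b : ℕ → Fin k) {x : Patch d} (hx : x ∈ X)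
    {T T' P : Set (Pt d)} (hT : T ∈ x) (hT' : T' ∈ x) (hne : T ≠ T')
    (hP : P ∈ substSeq S b m {T}) : interior P ∩ scl (Lam S b m) T' = ∅ := by
  have hL := Lam_pos S m b
  have h1 := super_int_disj hL (hX x hx).1 hT hT' hne
  have h2 : P ⊆ scl (Lam S b m) T := by
    rw [← psupp_super S m ⟨x, hx, hT⟩ b]
    exact mem_psupp_sub hP
  have h3 := int_disj_tile (scl_isTile hL (TilesOf_isTile hX ⟨x, hx, hT'⟩)) h1
  apply subset_empty_iff.1
  rw [← h3]
  exact inter_subset_inter_left _ (interior_mono h2)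

lemma super_disj' {d k : ℕ} {X : Set (Patch d)} (hX : ∀ x ∈ X, IsTiling x)
    (S : Fin k → Substitution d X) (m : ℕ) (b : ℕ → Fin k) {x : Patch d} (hx : x ∈ X)
    {T T' P : Set (Pt d)} (hT : T ∈ x) (hT' : T' ∈ x)
    (hP : P ∈ substSeq S b m {T}) (hP' : P ∈ substSeq S b m {T'}) : T = T' := by
  by_contra hne
  have h1 := super_disj hX S m b hx hT hT' hne hP
  have hPt : IsTile P := (hX _ (substSeq_X S m hx b)).1.1 P
    (substSeq_mono S m (by simpa using hT) b hP)
  obtain ⟨p, hp⟩ := hPt.int_ne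
  have h2 : P ⊆ scl (Lam S b m) T' := by
    rw [← psupp_super S m ⟨x, hx, hT'⟩ b]
    exact mem_psupp_sub hP'
  have : p ∈ interior P ∩ scl (Lam S b m) T' := ⟨hp, h2 (interior_subset hp)⟩
  rw [h1] at this
  exact this

/-! ### Null boundaries -/

lemma diam_bound {d l : ℕ} {X : Set (Patch d)} (hX : ∀ x ∈ X, IsTiling x)
    {Dp : Fin l → Set (Pt d)} (hDp : IsPrototileBasis X Dp) :
    ∃ ρ : ℝ, 0 < ρ ∧ ∀ T ∈ TilesOf X, ∀ p ∈ T, ∀ q ∈ T, dist p q ≤ ρ := by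
  refine ⟨1 + ∑ i, Metric.diam (Dp i), ?_, ?_⟩
  · have : 0 ≤ ∑ i, Metric.diam (Dp i) := Finset.sum_nonneg fun i _ => Metric.diam_nonneg
    linarith
  · intro T hT p hp q hq
    obtain ⟨i, t, rfl⟩ := hDp.2.2 T hT
    obtain ⟨p, hp, rfl⟩ := hp
    obtain ⟨q, hq, rfl⟩ := hq
    simp only [dist_add_left]
    have h1 := Metric.dist_le_diam_of_mem (TilesOf_isTile hX (hDp.1 i)).1.isBounded hp hq
    have h2 := Finset.single_le_sum (f := fun i => Metric.diam (Dp i))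
      (fun i _ => Metric.diam_nonneg) (Finset.mem_univ i)
    linarith

lemma exists_Lam_large {d k : ℕ} (hk : 0 < k) {X : Set (Patch d)} (S : Fin k → Substitution d X)
    (C : ℝ) : ∃ m₀ : ℕ, ∀ m ≥ m₀, ∀ b : ℕ → Fin k, C ≤ Lam S b m := by
  obtain ⟨κ, h1, h2⟩ := Lam_ge hk S
  have := (tendsto_pow_atTop_atTop_of_one_lt h1).eventually_ge_atTop C
  obtain ⟨m₀, hm⟩ := eventually_atTop.1 this
  exact ⟨m₀, fun m hmm b => (hm m hmm).trans (h2 m b)⟩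

/-- Some supertile of the tile `T` contains a tile in its interior. -/
lemma exists_inner_tile {d l k : ℕ} (hk : 0 < k) {X : Set (Patch d)}
    (hX : ∀ x ∈ X, IsTiling x) {Dp : Fin l → Set (Pt d)} (hDp : IsPrototileBasis X Dp)
    (S : Fin k → Substitution d X) {T : Set (Pt d)} (hT : T ∈ TilesOf X) (b : ℕ → Fin k) :
    ∃ m : ℕ, ∃ P ∈ substSeq S b m {T}, P ⊆ interior (scl (Lam S b m) T) := by
  obtain ⟨ρ, hρ, hdiam⟩ := diam_bound hX hDp
  have hTt := TilesOf_isTile hX hT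
  obtain ⟨p, hp⟩ := hTt.int_ne
  obtain ⟨ε, hε, hball⟩ := Metric.isOpen_iff.1 isOpen_interior p hp
  obtain ⟨m, hm⟩ := exists_Lam_large hk S (2 * ρ / ε)
  have hm := hm m le_rfl b
  have hL := Lam_pos S m b
  set c := Lam S b m with hc
  have hpc : c • p ∈ psupp (substSeq S b m {T}) := by
    rw [psupp_super S m hT]
    exact ⟨p, interior_subset hp, rfl⟩
  obtain ⟨P, hP, hpP⟩ := mem_iUnion₂.1 hpc
  refine ⟨m, P, hP, ?_⟩
  rw [interior_scl hL]
  intro q hq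
  refine ⟨c⁻¹ • q, hball ?_, ?_⟩
  · have h1 := hdiam P (Patches_tiles (substSeq_Patches S m (single_Patches hT) b) P hP) q hq _ hpP
    rw [Metric.mem_ball]
    have h2 : dist (c⁻¹ • q) p = c⁻¹ * dist q (c • p) := by
      have : p = c⁻¹ • (c • p) := by rw [smul_smul, inv_mul_cancel₀ hL.ne', one_smul]
      conv_lhs => rw [this]
      rw [dist_smul₀, Real.norm_of_nonneg (by positivity)]
    rw [h2, inv_mul_lt_iff₀ hL]
    rw [div_le_iff₀ hε] at hm
    linarith
  · simp only [smul_smul, mul_inv_cancel₀ hL.ne', one_smul]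

lemma frontier_null {d l k : ℕ} (hl : 0 < l) (hk : 0 < k) {X : Set (Patch d)}
    (hX : ∀ x ∈ X, IsTiling x) {Dp : Fin l → Set (Pt d)} (hDp : IsPrototileBasis X Dp)
    (S : Fin k → Substitution d X) {T : Set (Pt d)} (hT : T ∈ TilesOf X) :
    volume.real (frontier T) = 0 := by
  have : Nonempty (Fin l) := ⟨⟨0, hl⟩⟩
  set w : Set (Pt d) → ℝ := fun A => volume.real (frontier A) with hw
  set u : Set (Pt d) → ℝ := fun A => volume.real (interior A) with hu
  have hupos : ∀ T ∈ TilesOf X, 0 < u T := fun T hT => (TilesOf_isTile hX hT).int_vol_pos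
  obtain ⟨j, hj⟩ := Finite.exists_max (fun i => w (Dp i) / u (Dp i))
  set R := w (Dp j) / u (Dp j) with hR
  have hbound : ∀ T ∈ TilesOf X, w T ≤ R * u T := by
    intro T hT
    obtain ⟨i, t, rfl⟩ := hDp.2.2 T hT
    have h := hj i
    rw [div_le_iff₀ (hupos _ (hDp.1 i))] at h
    simpa only [hw, hu, frontier_tileTrans, interior_tileTrans, vol_tileTrans] using h
  have hRnn : 0 ≤ R := div_nonneg measureReal_nonneg (hupos _ (hDp.1 j)).le
  suffices hR0 : R = 0 by
    have := hbound T hT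
    rw [hR0, zero_mul] at this
    exact le_antisymm this measureReal_nonneg
  set b : ℕ → Fin k := fun _ => ⟨0, hk⟩
  obtain ⟨m, P, hP, hPint⟩ := exists_inner_tile hk hX hDp S (hDp.1 j) b
  have hL := Lam_pos S m b
  set c := Lam S b m with hc
  have hQ := substSeq_Patches S m (single_Patches (hDp.1 j)) b
  have hsupp := psupp_super S m (hDp.1 j) b
  set Q := substSeq S b m {Dp j} with hQdef
  obtain ⟨hQfin, x, hx, hQx⟩ := hQ
  have hQt : ∀ A ∈ Q, A ∈ TilesOf X := fun A hA => ⟨x, hx, hQx hA⟩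
  have htile := scl_isTile hL (TilesOf_isTile hX (hDp.1 j))
  -- frontier estimate
  have hfr : frontier (scl c (Dp j)) ⊆ ⋃ A ∈ hQfin.toFinset.erase P, frontier A := by
    intro y hy
    have hy1 : y ∈ scl c (Dp j) := htile.1.isClosed.frontier_subset hy
    rw [← hsupp] at hy1
    obtain ⟨A, hA, hyA⟩ := mem_iUnion₂.1 hy1
    have hsub : A ⊆ scl c (Dp j) := by rw [← hsupp]; exact mem_psupp_sub hA
    refine mem_iUnion₂.2 ⟨A, ?_, ?_⟩
    · rw [Finset.mem_erase]
      refine ⟨?_, by simpa using hA⟩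
      rintro rfl
      exact hy.2 (hPint hyA)
    · refine ⟨subset_closure hyA, fun h => hy.2 (interior_mono hsub h)⟩
  have hne : ∀ A ∈ Q, volume (interior A) ≠ ⊤ := fun A hA =>
    ((measure_mono interior_subset).trans_lt
      (TilesOf_isTile hX (hQt A hA)).1.measure_lt_top).ne
  have hfr2 : w (scl c (Dp j)) ≤ ∑ A ∈ hQfin.toFinset.erase P, w A := by
    refine le_trans (measureReal_mono hfr ?_) (measureReal_biUnion_finset_le _ _)
    refine (measure_biUnion_lt_top (Finset.finite_toSet _) ?_).ne
    intro A hA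
    have hA : A ∈ Q := by simpa using (Finset.mem_erase.1 hA).2
    have hc := (TilesOf_isTile hX (hQt A hA)).1
    exact (measure_mono hc.isClosed.frontier_subset).trans_lt hc.measure_lt_top
  have hintr : ∑ A ∈ hQfin.toFinset, u A ≤ u (scl c (Dp j)) := by
    have heq : volume.real (⋃ A ∈ hQfin.toFinset, interior A) = ∑ A ∈ hQfin.toFinset, u A := by
      apply measureReal_biUnion_finset
      · intro A hA B hB hAB
        exact disjoint_iff_inter_eq_empty.2
          ((hX x hx).1.2 A (hQx (by simpa using hA)) B (hQx (by simpa using hB)) hAB)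
      · intro A _
        exact isOpen_interior.measurableSet
      · intro A hA
        exact hne A (by simpa using hA)
    rw [← heq]
    refine measureReal_mono ?_ ?_
    · refine iUnion₂_subset fun A hA => interior_mono ?_
      rw [← hsupp]
      exact mem_psupp_sub (by simpa using hA)
    · exact ((measure_mono interior_subset).trans_lt htile.1.measure_lt_top).ne
  have hsum := Finset.add_sum_erase hQfin.toFinset u (a := P) (by simpa using hP)
  have h1 : ∑ A ∈ hQfin.toFinset.erase P, w A ≤ R * ∑ A ∈ hQfin.toFinset.erase P, u A := by
    rw [Finset.mul_sum]
    refine Finset.sum_le_sum fun A hA => hbound A (hQt A ?_)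
    simpa using (Finset.mem_erase.1 hA).2
  have hw2 : w (scl c (Dp j)) = R * u (scl c (Dp j)) := by
    simp only [hw, hu, frontier_scl hL, interior_scl hL, vol_scl hL]
    have : w (Dp j) = R * u (Dp j) := by
      rw [hR, div_mul_cancel₀ _ (hupos _ (hDp.1 j)).ne']
    simp only [hw, hu] at this
    rw [this]; ring
  have hPp := hupos P (hQt P hP)
  have h2 : R * (∑ A ∈ hQfin.toFinset, u A) ≤ R * u (scl c (Dp j)) :=
    mul_le_mul_of_nonneg_left hintr hRnn
  rw [← hsum, mul_add] at h2
  have h3 : R * u P ≤ 0 := by linarith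
  by_contra hne0
  have := mul_pos (lt_of_le_of_ne hRnn (Ne.symm hne0)) hPp
  linarith

/-- Volumes of supertiles add up. -/
lemma vol_sum {d k : ℕ} {X : Set (Patch d)}
    (hX : ∀ x ∈ X, IsTiling x)
    (hnull : ∀ T ∈ TilesOf X, volume.real (frontier T) = 0)
    (S : Fin k → Substitution d X) (m : ℕ) (b : ℕ → Fin k) {x z : Patch d} (hx : x ∈ X)
    (hz : z ⊆ x) (hzf : z.Finite) :
    volume.real (psupp (substSeq S b m z)) =
      ∑ T ∈ hzf.toFinset, volume.real (scl (Lam S b m) T) := by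
  have hL := Lam_pos S m b
  have h1 : psupp (substSeq S b m z) = ⋃ T ∈ hzf.toFinset, scl (Lam S b m) T := by
    rw [psupp_substSeq S m ⟨hzf, x, hx, hz⟩]
    simp only [psupp, scl, image_iUnion₂, Set.Finite.mem_toFinset]
  have htile : ∀ T ∈ z, IsTile (scl (Lam S b m) T) := fun T hT =>
    scl_isTile hL (TilesOf_isTile hX ⟨x, hx, hz hT⟩)
  rw [h1]
  apply measureReal_biUnion_finset₀
  · intro A hA B hB hAB
    have hA : A ∈ z := by simpa using hA
    have hB : B ∈ z := by simpa using hB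
    have hd := super_int_disj hL (hX x hx).1 (hz hA) (hz hB) hAB
    have hd2 := int_disj_tile (htile B hB) hd
    have hsub : scl (Lam S b m) A ∩ scl (Lam S b m) B ⊆ frontier (scl (Lam S b m) A) := by
      intro y hy
      refine ⟨subset_closure hy.1, fun h => ?_⟩
      have : y ∈ interior (scl (Lam S b m) A) ∩ scl (Lam S b m) B := ⟨h, hy.2⟩
      rw [hd2] at this
      exact this
    refine measure_mono_null hsub ?_
    have h0 : volume.real (frontier (scl (Lam S b m) A)) = 0 := by
      rw [frontier_scl hL, vol_scl hL, hnull A ⟨x, hx, hz hA⟩, mul_zero]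
    rw [measureReal_def, ENNReal.toReal_eq_zero_iff] at h0
    refine h0.resolve_right ?_
    have hc := (htile A hA).1
    exact ((measure_mono hc.isClosed.frontier_subset).trans_lt hc.measure_lt_top).ne
  · intro A hA
    exact (htile A (by simpa using hA)).1.measurableSet.nullMeasurableSet
  · intro A hA
    exact (htile A (by simpa using hA)).vol_ne_top

lemma plusR_sub_cthickening {d : ℕ} (A : Set (Pt d)) {r : ℝ} :
    plusR A r ⊆ Metric.cthickening r A := by
  rintro y ⟨h, hh, hd⟩
  exact Metric.mem_cthickening_of_dist_le y h r A hh hd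

lemma plusR_mono {d : ℕ} {A : Set (Pt d)} {r s : ℝ} (h : r ≤ s) : plusR A r ⊆ plusR A s := by
  rintro y ⟨a, ha, hd⟩
  exact ⟨a, ha, hd.trans h⟩

lemma plusR_bdd {d : ℕ} {A : Set (Pt d)} (hA : Bornology.IsBounded A) (r : ℝ) :
    volume (plusR A r) ≠ ⊤ :=
  (hA.cthickening.subset (plusR_sub_cthickening A)).measure_lt_top.ne

lemma plusR_scl {d : ℕ} {c : ℝ} (hc : 0 < c) (A : Set (Pt d)) (r : ℝ) :
    plusR (scl c A) r = scl c (plusR A (r / c)) := by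
  ext y
  constructor
  · rintro ⟨_, ⟨a, ha, rfl⟩, hd⟩
    refine ⟨c⁻¹ • y, ⟨a, ha, ?_⟩, ?_⟩
    · have h1 : dist (c⁻¹ • y) a = c⁻¹ * dist y (c • a) := by
        have : a = c⁻¹ • (c • a) := by rw [smul_smul, inv_mul_cancel₀ hc.ne', one_smul]
        conv_lhs => rw [this]
        rw [dist_smul₀, Real.norm_of_nonneg (by positivity)]
      rw [h1, div_eq_inv_mul]
      exact mul_le_mul_of_nonneg_left hd (by positivity)
    · simp only [smul_smul, mul_inv_cancel₀ hc.ne', one_smul]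
  · rintro ⟨q, ⟨a, ha, hd⟩, rfl⟩
    refine ⟨c • a, ⟨a, ha, rfl⟩, ?_⟩
    simp only [dist_smul₀, Real.norm_of_nonneg hc.le]
    rw [le_div_iff₀ hc] at hd
    linarith

lemma plusR_tileTrans {d : ℕ} (t : Pt d) (A : Set (Pt d)) (r : ℝ) :
    plusR (tileTrans t A) r = tileTrans t (plusR A r) := by
  ext y
  constructor
  · rintro ⟨_, ⟨a, ha, rfl⟩, hd⟩
    refine ⟨-t + y, ⟨a, ha, ?_⟩, by simp⟩
    rw [← dist_add_left t]
    simpa using hd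
  · rintro ⟨q, ⟨a, ha, hd⟩, rfl⟩
    exact ⟨t + a, ⟨a, ha, rfl⟩, by simpa using hd⟩

/-- Uniform smallness of the boundary of large supertiles. -/
lemma boundary_small {d l k : ℕ} (hk : 0 < k) {X : Set (Patch d)}
    (hX : ∀ x ∈ X, IsTiling x) {Dp : Fin l → Set (Pt d)} (hDp : IsPrototileBasis X Dp)
    (hnull : ∀ T ∈ TilesOf X, volume.real (frontier T) = 0)
    (S : Fin k → Substitution d X) (r : ℝ) (hr : 0 < r) (ε : ℝ) (hε : 0 < ε) :
    ∃ m₀ : ℕ, ∀ m ≥ m₀, ∀ b : ℕ → Fin k, ∀ T ∈ TilesOf X,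
      volume.real (plusR (frontier (scl (Lam S b m) T)) r) ≤
        ε * volume.real (scl (Lam S b m) T) := by
  have hcpt : ∀ i, IsCompact (frontier (Dp i)) := fun i => by
    have hc := (TilesOf_isTile hX (hDp.1 i)).1
    exact hc.of_isClosed_subset isClosed_frontier hc.isClosed.frontier_subset
  have h1 : ∀ i, ∃ δ > 0, ∀ s, 0 ≤ s → s < δ →
      volume.real (plusR (frontier (Dp i)) s) ≤ ε * volume.real (Dp i) := by
    intro i
    have ht := tendsto_measure_cthickening_of_isCompact (μ := (volume : Measure (Pt d))) (hcpt i)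
    have h0 : volume (frontier (Dp i)) = 0 := by
      have := hnull _ (hDp.1 i)
      rw [measureReal_def, ENNReal.toReal_eq_zero_iff] at this
      exact this.resolve_right (hcpt i).measure_lt_top.ne
    rw [h0] at ht
    have hpos : 0 < ε * volume.real (Dp i) :=
      mul_pos hε (TilesOf_isTile hX (hDp.1 i)).vol_pos
    have hev := ht.eventually_lt_const (u := ENNReal.ofReal (ε * volume.real (Dp i)))
      (by simpa using hpos)
    obtain ⟨δ, hδ, hball⟩ := Metric.eventually_nhds_iff.1 hev
    refine ⟨δ, hδ, fun s hs hsδ => ?_⟩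
    have h2 := hball (y := s) (by simpa [abs_of_nonneg hs] using hsδ)
    have h3 := (measure_mono (plusR_sub_cthickening (frontier (Dp i)) (r := s))).trans h2.le
    exact ENNReal.toReal_le_of_le_ofReal hpos.le h3
  choose δ hδ hδ2 using h1
  have h2 : ∀ i, ∃ m₀ : ℕ, ∀ m ≥ m₀, ∀ b : ℕ → Fin k, r / δ i + 1 ≤ Lam S b m :=
    fun i => exists_Lam_large hk S _
  choose m₀ hm₀ using h2
  refine ⟨∑ i, m₀ i, fun m hm b T hT => ?_⟩
  obtain ⟨i, t, rfl⟩ := hDp.2.2 T hT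
  have hL := Lam_pos S m b
  have hmi : m₀ i ≤ m :=
    (Finset.single_le_sum (f := m₀) (fun _ _ => Nat.zero_le _) (Finset.mem_univ i)).trans hm
  have hLi := hm₀ i m hmi b
  rw [scl_tileTrans, frontier_tileTrans, plusR_tileTrans, vol_tileTrans, vol_tileTrans,
    frontier_scl hL, plusR_scl hL, vol_scl hL, vol_scl hL]
  have h3 : r / Lam S b m < δ i := by
    rw [div_lt_iff₀ hL]
    have : r / δ i < Lam S b m := by linarith
    rw [div_lt_iff₀ (hδ i)] at this
    linarith
  have := hδ2 i _ (by positivity) h3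
  have hp : 0 < Lam S b m ^ d := by positivity
  nlinarith

/-! ### Counting patches in unions of supertiles -/

lemma occ_finite {d : ℕ} {x' y : Patch d} {P₀ : Set (Pt d)} (hP₀ : P₀ ∈ x') (hPt : IsTile P₀)
    (hy : y.Finite) : {t : Pt d | patchTrans t x' ⊆ y}.Finite := by
  refine (hy.preimage (f := fun t => tileTrans t P₀) ?_).subset ?_
  · intro s _ t _ h
    exact tileTrans_left_inj hPt h
  · intro t ht
    exact ht ⟨P₀, hP₀, rfl⟩

lemma lower_count {d k : ℕ} {X : Set (Patch d)} (hX : ∀ x ∈ X, IsTiling x)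
    (hnull : ∀ T ∈ TilesOf X, volume.real (frontier T) = 0)
    (S : Fin k → Substitution d X) (m : ℕ) (b : ℕ → Fin k) {x z : Patch d} (hx : x ∈ X)
    (hz : z ⊆ x) (hzf : z.Finite) {x' : Patch d} {P₀ : Set (Pt d)} (hP₀ : P₀ ∈ x')
    (hPt : IsTile P₀) {α : ℝ}
    (hα : ∀ T ∈ z, α * volume.real (scl (Lam S b m) T) ≤ Lcount x' (substSeq S b m {T})) :
    α * volume.real (psupp (substSeq S b m z)) ≤ Lcount x' (substSeq S b m z) := by
  classical
  rw [vol_sum hX hnull S m b hx hz hzf, Finset.mul_sum]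
  have hfin : ∀ T ∈ z, {t : Pt d | patchTrans t x' ⊆ substSeq S b m {T}}.Finite := fun T hT =>
    occ_finite hP₀ hPt (substSeq_Patches S m (single_Patches ⟨x, hx, hz hT⟩) b).1
  have hfin2 : {t : Pt d | patchTrans t x' ⊆ substSeq S b m z}.Finite :=
    occ_finite hP₀ hPt (substSeq_Patches S m ⟨hzf, x, hx, hz⟩ b).1
  have h1 : ∑ T ∈ hzf.toFinset, Lcount x' (substSeq S b m {T})
      ≤ Lcount x' (substSeq S b m z) := by
    have h2 := Set.Finite.ncard_biUnion hzf
      (s := fun T => {t : Pt d | patchTrans t x' ⊆ substSeq S b m {T}}) hfin (by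
        intro A hA B hB hAB
        refine Set.disjoint_left.2 fun t htA htB => hAB ?_
        exact super_disj' hX S m b hx (hz hA) (hz hB) (htA ⟨P₀, hP₀, rfl⟩) (htB ⟨P₀, hP₀, rfl⟩))
    rw [finsum_mem_eq_finite_toFinset_sum _ hzf] at h2
    unfold Lcount
    rw [← h2]
    refine Set.ncard_le_ncard ?_ hfin2
    refine iUnion₂_subset fun T hT t ht => ?_
    exact subset_trans ht (substSeq_mono S m (by simpa using hT) b)
  refine le_trans (Finset.sum_le_sum fun T hT => hα T (by simpa using hT)) ?_
  exact_mod_cast h1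

lemma upper_count {d k : ℕ} {X : Set (Patch d)} (hX : ∀ x ∈ X, IsTiling x)
    (hnull : ∀ T ∈ TilesOf X, volume.real (frontier T) = 0)
    (S : Fin k → Substitution d X) (m : ℕ) (b : ℕ → Fin k) {x z z₂ : Patch d} (hx : x ∈ X)
    (hz : z ⊆ x) (hz₂ : z₂ ⊆ z) (hzf : z₂.Finite) {x' : Patch d} {P₀ : Set (Pt d)}
    (hP₀ : P₀ ∈ x') (hPt : IsTile P₀) {r : ℝ}
    (hr : ∀ p ∈ psupp x', ∀ q ∈ psupp x', dist p q ≤ r) {β δ : ℝ}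
    (hβ : ∀ T ∈ z₂, (Lcount x' (substSeq S b m {T}) : ℝ) ≤ β * volume.real (scl (Lam S b m) T))
    (hδ : ∀ T ∈ z₂, volume.real (plusR (frontier (scl (Lam S b m) T)) r) ≤
      δ * volume.real (interior P₀) * volume.real (scl (Lam S b m) T)) :
    ({t : Pt d | patchTrans t x' ⊆ substSeq S b m z ∧ tileTrans t P₀ ∈ substSeq S b m z₂}.ncard : ℝ)
      ≤ (β + δ) * volume.real (psupp (substSeq S b m z₂)) := by
  classical
  have hL := Lam_pos S m b
  have hu := hPt.int_vol_pos
  rw [vol_sum hX hnull S m b hx (hz₂.trans hz) hzf, Finset.mul_sum]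
  set E : Set (Pt d) → Set (Pt d) := fun T => {t | tileTrans t P₀ ∈ substSeq S b m x ∧
    tileTrans t P₀ ⊆ plusR (frontier (scl (Lam S b m) T)) r} with hE
  have hEc : ∀ T ∈ z₂, (E T).Finite ∧
      ((E T).ncard : ℝ) ≤ δ * volume.real (scl (Lam S b m) T) := by
    intro T hT
    have htile := scl_isTile hL (TilesOf_isTile hX ⟨x, hx, hz (hz₂ hT)⟩)
    have := count_le (hX _ (substSeq_X S m hx b)).1 hPt
      (B := plusR (frontier (scl (Lam S b m) T)) r)
      (plusR_bdd (htile.1.isBounded.subset htile.1.isClosed.frontier_subset) r)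
      (E := E T) (fun t ht => ht)
    refine ⟨this.1, ?_⟩
    have h2 := this.2.trans (hδ T hT)
    have h3 : ((E T).ncard : ℝ) * volume.real (interior P₀) ≤
        (δ * volume.real (scl (Lam S b m) T)) * volume.real (interior P₀) := by linarith
    exact le_of_mul_le_mul_right h3 hu
  have hfin : ∀ T ∈ z₂, {t : Pt d | patchTrans t x' ⊆ substSeq S b m {T}}.Finite := fun T hT =>
    occ_finite hP₀ hPt (substSeq_Patches S m (single_Patches ⟨x, hx, hz (hz₂ hT)⟩) b).1
  have hsub : {t : Pt d | patchTrans t x' ⊆ substSeq S b m z ∧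
      tileTrans t P₀ ∈ substSeq S b m z₂} ⊆
      ⋃ T ∈ hzf.toFinset, ({t : Pt d | patchTrans t x' ⊆ substSeq S b m {T}} ∪ E T) := by
    rintro t ⟨ht1, ht2⟩
    obtain ⟨T, hT, hPT⟩ := (mem_substSeq S m z₂ b _).1 ht2
    refine mem_iUnion₂.2 ⟨T, by simpa using hT, ?_⟩
    by_cases hall : patchTrans t x' ⊆ substSeq S b m {T}
    · exact Or.inl hall
    · right
      rw [Set.not_subset] at hall
      obtain ⟨P, hPx, hPn⟩ := hall
      obtain ⟨T', hT', hPT'⟩ := (mem_substSeq S m z b _).1 (ht1 hPx)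
      have hne : T' ≠ T := by
        rintro rfl
        exact hPn hPT'
      have hdis := super_disj hX S m b hx (hz hT') (hz (hz₂ hT)) hne hPT'
      have hPtile : IsTile P := (hX _ (substSeq_X S m hx b)).1.1 P
        (substSeq_mono S m hz b (ht1 hPx))
      obtain ⟨p, hp⟩ := hPtile.int_ne
      have hpn : p ∉ scl (Lam S b m) T := by
        intro h
        have : p ∈ interior P ∩ scl (Lam S b m) T := ⟨hp, h⟩
        rw [hdis] at this
        exact this
      refine ⟨substSeq_mono S m hz b (ht1 ⟨P₀, hP₀, rfl⟩), ?_⟩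
      intro q hq
      have hqT : q ∈ scl (Lam S b m) T := by
        rw [← psupp_super S m ⟨x, hx, hz (hz₂ hT)⟩ b]
        exact mem_psupp_sub hPT hq
      obtain ⟨f, hf, hfd⟩ := exists_frontier hqT hpn
      refine ⟨f, hf, hfd.trans ?_⟩
      obtain ⟨P₁, hP₁, rfl⟩ := hPx
      obtain ⟨p', hp', rfl⟩ := interior_subset hp
      obtain ⟨q', hq', rfl⟩ := hq
      simp only [dist_add_left]
      exact hr _ (mem_psupp_sub hP₀ hq') _ (mem_psupp_sub hP₁ hp')
  have hfinU : (⋃ T ∈ hzf.toFinset,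
      ({t : Pt d | patchTrans t x' ⊆ substSeq S b m {T}} ∪ E T)).Finite := by
    refine Set.Finite.biUnion (Finset.finite_toSet _) fun T hT => ?_
    have hT : T ∈ z₂ := by simpa using hT
    exact (hfin T hT).union (hEc T hT).1
  have h1 := (Set.ncard_le_ncard hsub hfinU).trans (Finset.set_ncard_biUnion_le _ _)
  refine le_trans (Nat.cast_le.2 h1) ?_
  rw [Nat.cast_sum]
  refine Finset.sum_le_sum fun T hT => ?_
  have hT : T ∈ z₂ := by simpa using hT
  refine le_trans (Nat.cast_le.2 (Set.ncard_union_le _ _)) ?_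
  rw [Nat.cast_add, add_mul]
  exact add_le_add (hβ T hT) (hEc T hT).2

/-! ### Regions and hierarchical tilings -/

lemma patchTrans_mono {d : ℕ} (t : Pt d) {x y : Patch d} (h : x ⊆ y) :
    patchTrans t x ⊆ patchTrans t y := image_mono h

lemma Lcount_trans {d : ℕ} (x' y : Patch d) (s : Pt d) :
    Lcount x' (patchTrans s y) = Lcount x' y := by
  unfold Lcount
  have : {t : Pt d | patchTrans t x' ⊆ patchTrans s y}
      = (fun t => s + t) '' {t : Pt d | patchTrans t x' ⊆ y} := by
    ext t
    constructor
    · intro ht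
      refine ⟨-s + t, ?_, by simp⟩
      have := patchTrans_mono (-s) ht
      simpa [patchTrans_add, patchTrans_zero] using this
    · rintro ⟨t, ht, rfl⟩
      have := patchTrans_mono s ht
      simpa [patchTrans_add] using this
  rw [this, Set.ncard_image_of_injective _ (add_right_injective s)]

lemma Patches_trans {d : ℕ} {X : Set (Patch d)} (hXinv : TransInvariant X) {z : Patch d}
    (hz : z ∈ Patches X) (t : Pt d) : patchTrans t z ∈ Patches X := by
  obtain ⟨hf, x, hx, hzx⟩ := hz
  exact ⟨hf.image _, patchTrans t x, hXinv t x hx, patchTrans_mono t hzx⟩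

lemma local_finite {d l : ℕ} {X : Set (Patch d)} (hX : ∀ x ∈ X, IsTiling x)
    {Dp : Fin l → Set (Pt d)} (hDp : IsPrototileBasis X Dp) {x : Patch d} (hx : x ∈ X)
    {B : Set (Pt d)} (hB : Bornology.IsBounded B) : {P | P ∈ x ∧ (P ∩ B).Nonempty}.Finite := by
  obtain ⟨ρ, hρ, hdiam⟩ := diam_bound hX hDp
  have hsub : {P | P ∈ x ∧ (P ∩ B).Nonempty} ⊆ ⋃ i : Fin l, (fun t => tileTrans t (Dp i)) ''
      {t | tileTrans t (Dp i) ∈ x ∧ tileTrans t (Dp i) ⊆ Metric.cthickening ρ B} := by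
    rintro P ⟨hP, p, hp, hpB⟩
    have hPX : P ∈ TilesOf X := ⟨x, hx, hP⟩
    obtain ⟨i, t, rfl⟩ := hDp.2.2 P hPX
    refine mem_iUnion.2 ⟨i, t, ⟨hP, fun q hq => ?_⟩, rfl⟩
    exact Metric.mem_cthickening_of_dist_le q p ρ B hpB (hdiam _ hPX q hq p hp)
  refine (Set.finite_iUnion fun i => Set.Finite.image _ ?_).subset hsub
  exact (count_le (hX x hx).1 (TilesOf_isTile hX (hDp.1 i))
    (B := Metric.cthickening ρ B) hB.cthickening.measure_lt_top.ne (fun t ht => ht)).1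

lemma hier_cover {d l k : ℕ} {X : Set (Patch d)} (hX : ∀ x ∈ X, IsTiling x)
    (hXinv : TransInvariant X)
    {Dp : Fin l → Set (Pt d)} (hDp : IsPrototileBasis X Dp)
    (S : Fin k → Substitution d X) (b : ℕ → Fin k) {x : Patch d} (hx : x ∈ X)
    (hh : Hierarchical S b x) {B : Set (Pt d)} (hB : Bornology.IsBounded B) (m : ℕ) :
    ∃ z ∈ Patches X, substSeq S b m z ⊆ x ∧
      ∀ P ∈ x, (P ∩ B).Nonempty → P ∈ substSeq S b m z := by
  obtain ⟨kn, tn, D', hD', hkn, hmono, hxU⟩ := hh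
  have hG := local_finite hX hDp hx hB
  have hmon : Monotone fun n => patchTrans (tn n) (substSeq S b (kn n) {D'}) :=
    monotone_nat_of_le_succ hmono
  have h1 : ∀ P ∈ {P | P ∈ x ∧ (P ∩ B).Nonempty},
      ∃ n, P ∈ patchTrans (tn n) (substSeq S b (kn n) {D'}) := by
    rintro P ⟨hP, _⟩
    rw [hxU] at hP
    exact mem_iUnion.1 hP
  choose! f hf using h1
  obtain ⟨N, hN⟩ := (hG.image f).bddAbove
  obtain ⟨n, hnN, hnm⟩ := ((eventually_ge_atTop N).and (hkn.eventually_ge_atTop m)).exists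
  have hL := Lam_pos S m b
  set w := substSeq S (fun i => b (i + m)) (kn n - m) {D'} with hw
  have hwP : w ∈ Patches X := substSeq_Patches S _ (single_Patches hD') _
  have heq : patchTrans (tn n) (substSeq S b (kn n) {D'}) =
      substSeq S b m (patchTrans ((Lam S b m)⁻¹ • tn n) w) := by
    rw [substSeq_trans, smul_smul, mul_inv_cancel₀ hL.ne', one_smul, hw, ← substSeq_add,
      Nat.add_sub_cancel' hnm]
  refine ⟨_, Patches_trans hXinv hwP ((Lam S b m)⁻¹ • tn n), ?_, ?_⟩
  · rw [← heq, hxU]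
    exact subset_iUnion (fun n => patchTrans (tn n) (substSeq S b (kn n) {D'})) n
  · intro P hP hPB
    rw [← heq]
    exact hmon ((hN ⟨P, ⟨hP, hPB⟩, rfl⟩).trans hnN) (hf P ⟨hP, hPB⟩)

lemma region_count {d l k : ℕ} {X : Set (Patch d)} (hX : ∀ x ∈ X, IsTiling x)
    (hXinv : TransInvariant X)
    {Dp : Fin l → Set (Pt d)} (hDp : IsPrototileBasis X Dp)
    (hnull : ∀ T ∈ TilesOf X, volume.real (frontier T) = 0)
    (S : Fin k → Substitution d X) (m : ℕ) (b : ℕ → Fin k) {y : Patch d} (hy : y ∈ X)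
    (hh : Hierarchical S b y) {x' : Patch d} {P₀ : Set (Pt d)} (hP₀ : P₀ ∈ x')
    (hx't : ∀ P ∈ x', IsTile P) {r : ℝ}
    (hr : ∀ p ∈ psupp x', ∀ q ∈ psupp x', dist p q ≤ r) {α β δ : ℝ} (hα0 : 0 ≤ α)
    (hβδ : 0 ≤ β + δ)
    (hα : ∀ T ∈ TilesOf X,
      α * volume.real (scl (Lam S b m) T) ≤ Lcount x' (substSeq S b m {T}))
    (hβ : ∀ T ∈ TilesOf X,
      (Lcount x' (substSeq S b m {T}) : ℝ) ≤ β * volume.real (scl (Lam S b m) T))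
    (hδ : ∀ T ∈ TilesOf X, volume.real (plusR (frontier (scl (Lam S b m) T)) r) ≤
      δ * volume.real (interior P₀) * volume.real (scl (Lam S b m) T))
    {ρ : ℝ} (hρ : ∀ T ∈ TilesOf X, ∀ p ∈ T, ∀ q ∈ T, dist p q ≤ ρ)
    {H : Set (Pt d)} (hH : Bornology.IsBounded H) :
    α * (volume.real H - volume.real (plusR (frontier H) (Lam S b m * ρ))) ≤ LcountIn y x' H ∧
    (LcountIn y x' H : ℝ) ≤
      (β + δ) * (volume.real H + volume.real (plusR (frontier H) (Lam S b m * ρ))) := by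
  have hL := Lam_pos S m b
  set c := Lam S b m with hc
  obtain ⟨z, ⟨hzf, x, hx, hzx⟩, hzy, hcov⟩ := hier_cover hX hXinv hDp S b hy hh hH m
  have hzX : ∀ T ∈ z, T ∈ TilesOf X := fun T hT => ⟨x, hx, hzx hT⟩
  have hρ' : ∀ T ∈ z, ∀ p ∈ scl c T, ∀ q ∈ scl c T, dist p q ≤ c * ρ := by
    rintro T hT _ ⟨p, hp, rfl⟩ _ ⟨q, hq, rfl⟩
    simp only [dist_smul₀, Real.norm_of_nonneg hL.le]
    exact mul_le_mul_of_nonneg_left (hρ T (hzX T hT) p hp q hq) hL.le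
  have hHfin : volume H ≠ ⊤ := hH.measure_lt_top.ne
  have hFfin : volume (plusR (frontier H) (c * ρ)) ≠ ⊤ :=
    plusR_bdd (hH.closure.subset frontier_subset_closure) _
  have hfin : {t : Pt d | patchTrans t x' ⊆ substSeq S b m z}.Finite :=
    occ_finite hP₀ (hx't P₀ hP₀) (substSeq_Patches S m ⟨hzf, x, hx, hzx⟩ b).1
  have hset : ∀ t, (patchTrans t x' ⊆ y ∧ psupp (patchTrans t x') ⊆ H) →
      patchTrans t x' ⊆ substSeq S b m z := by
    rintro t ⟨h1, h2⟩ _ ⟨P, hP, rfl⟩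
    refine hcov _ (h1 ⟨P, hP, rfl⟩) ?_
    obtain ⟨p, hp⟩ := (hx't P hP).2.1.nonempty
    exact ⟨t + p, ⟨p, hp, rfl⟩, h2 (mem_psupp_sub (x := patchTrans t x') (P := tileTrans t P) ⟨P, hP, rfl⟩ ⟨p, hp, rfl⟩)⟩
  have hfin2 : {t : Pt d | patchTrans t x' ⊆ y ∧ psupp (patchTrans t x') ⊆ H}.Finite :=
    hfin.subset hset
  have hpsz : ∀ w ⊆ z, ∀ p, p ∈ psupp (substSeq S b m w) ↔ ∃ T ∈ w, p ∈ scl c T := by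
    intro w hw p
    rw [psupp_substSeq S m ⟨hzf.subset hw, x, hx, hw.trans hzx⟩]
    simp only [psupp, scl, image_iUnion₂, mem_iUnion₂, exists_prop, ← hc]
  constructor
  · set z₁ : Patch d := {T | T ∈ z ∧ scl c T ⊆ H} with hz₁
    have hz₁z : z₁ ⊆ z := fun T hT => hT.1
    have h1 := lower_count hX hnull S m b hx (hz₁z.trans hzx) (hzf.subset hz₁z) hP₀
      (hx't P₀ hP₀) (α := α) (fun T hT => hα T (hzX T (hz₁z hT)))
    have h2 : Lcount x' (substSeq S b m z₁) ≤ LcountIn y x' H := by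
      refine Set.ncard_le_ncard ?_ hfin2
      intro t ht
      refine ⟨subset_trans ht ((substSeq_mono S m hz₁z b).trans hzy), ?_⟩
      intro p hp
      obtain ⟨P, hP, hpP⟩ := mem_iUnion₂.1 hp
      obtain ⟨T, hT, hpT⟩ := (hpsz z₁ hz₁z p).1 (mem_psupp_sub (ht hP) hpP)
      exact hT.2 hpT
    have h3 : H ⊆ psupp (substSeq S b m z₁) ∪ plusR (frontier H) (c * ρ) := by
      intro p hp
      have hpu : p ∈ psupp y := by rw [(hX y hy).2]; trivial
      obtain ⟨P, hP, hpP⟩ := mem_iUnion₂.1 hpu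
      have hPz := hcov P hP ⟨p, hpP, hp⟩
      obtain ⟨T, hT, hpT⟩ := (hpsz z subset_rfl p).1 (mem_psupp_sub hPz hpP)
      by_cases hTH : scl c T ⊆ H
      · exact Or.inl ((hpsz z₁ hz₁z p).2 ⟨T, ⟨hT, hTH⟩, hpT⟩)
      · right
        obtain ⟨q, hqT, hqH⟩ := Set.not_subset.1 hTH
        obtain ⟨f, hf, hfd⟩ := exists_frontier hp hqH
        exact ⟨f, hf, hfd.trans (hρ' T hT p hpT q hqT)⟩
    have hsf : volume (psupp (substSeq S b m z₁)) ≠ ⊤ := by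
      refine ((measure_mono (t := H) ?_).trans_lt hH.measure_lt_top).ne
      intro p hp
      obtain ⟨T, hT, hpT⟩ := (hpsz z₁ hz₁z p).1 hp
      exact hT.2 hpT
    have h4 : volume.real H ≤ volume.real (psupp (substSeq S b m z₁)) +
        volume.real (plusR (frontier H) (c * ρ)) :=
      (measureReal_mono h3 (measure_union_ne_top hsf hFfin)).trans (measureReal_union_le _ _)
    have h5 : (Lcount x' (substSeq S b m z₁) : ℝ) ≤ LcountIn y x' H := by exact_mod_cast h2
    refine le_trans (mul_le_mul_of_nonneg_left ?_ hα0) (h1.trans h5)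
    linarith
  · set z₂ : Patch d := {T | T ∈ z ∧ (scl c T ∩ H).Nonempty} with hz₂
    have hz₂z : z₂ ⊆ z := fun T hT => hT.1
    have h1 := upper_count hX hnull S m b hx hzx hz₂z (hzf.subset hz₂z) hP₀
      (hx't P₀ hP₀) hr (β := β) (δ := δ) (fun T hT => hβ T (hzX T (hz₂z hT)))
      (fun T hT => hδ T (hzX T (hz₂z hT)))
    have h2 : LcountIn y x' H ≤ {t : Pt d | patchTrans t x' ⊆ substSeq S b m z ∧
        tileTrans t P₀ ∈ substSeq S b m z₂}.ncard := by
      refine Set.ncard_le_ncard ?_ (hfin.subset fun t ht => ht.1)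
      intro t ht
      have hts := hset t ht
      refine ⟨hts, ?_⟩
      obtain ⟨T, hT, hPT⟩ := (mem_substSeq S m z b _).1 (hts ⟨P₀, hP₀, rfl⟩)
      refine (mem_substSeq S m z₂ b _).2 ⟨T, ⟨hT, ?_⟩, hPT⟩
      obtain ⟨p, hp⟩ := (hx't P₀ hP₀).2.1.nonempty
      refine ⟨t + p, ?_, ht.2 (mem_psupp_sub (x := patchTrans t x') (P := tileTrans t P₀) ⟨P₀, hP₀, rfl⟩ ⟨p, hp, rfl⟩)⟩
      rw [hc, ← psupp_super S m (hzX T hT) b]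
      exact mem_psupp_sub hPT ⟨p, hp, rfl⟩
    have h3 : psupp (substSeq S b m z₂) ⊆ H ∪ plusR (frontier H) (c * ρ) := by
      intro q hq
      obtain ⟨T, ⟨hT, p, hpT, hpH⟩, hqT⟩ := (hpsz z₂ hz₂z q).1 hq
      by_cases hqH : q ∈ H
      · exact Or.inl hqH
      · right
        obtain ⟨f, hf, hfd⟩ := exists_frontier (A := Hᶜ) (p := q) (q := p) hqH (by simpa using hpH)
        rw [frontier_compl] at hf
        exact ⟨f, hf, hfd.trans (hρ' T hT q hqT p hpT)⟩
    have h4 : volume.real (psupp (substSeq S b m z₂)) ≤ volume.real H +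
        volume.real (plusR (frontier H) (c * ρ)) :=
      (measureReal_mono h3 (measure_union_ne_top hHfin hFfin)).trans (measureReal_union_le _ _)
    exact (Nat.cast_le.2 h2).trans (h1.trans (mul_le_mul_of_nonneg_left h4 hβδ))

lemma freq_bounds {d l k : ℕ} {X : Set (Patch d)} (hX : ∀ x ∈ X, IsTiling x)
    {Dp : Fin l → Set (Pt d)} (hDp : IsPrototileBasis X Dp)
    (hnull : ∀ T ∈ TilesOf X, volume.real (frontier T) = 0)
    (S : Fin k → Substitution d X) (m : ℕ) (b : ℕ → Fin k)
    {x' : Patch d} {P₀ : Set (Pt d)} (hP₀ : P₀ ∈ x')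
    (hPt : IsTile P₀) {r : ℝ}
    (hr : ∀ p ∈ psupp x', ∀ q ∈ psupp x', dist p q ≤ r) {α β δ : ℝ}
    (hα : ∀ T ∈ TilesOf X,
      α * volume.real (scl (Lam S b m) T) ≤ Lcount x' (substSeq S b m {T}))
    (hβ : ∀ T ∈ TilesOf X,
      (Lcount x' (substSeq S b m {T}) : ℝ) ≤ β * volume.real (scl (Lam S b m) T))
    (hδ : ∀ T ∈ TilesOf X, volume.real (plusR (frontier (scl (Lam S b m) T)) r) ≤
      δ * volume.real (interior P₀) * volume.real (scl (Lam S b m) T))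
    {c : ℝ} (j : Fin l)
    (hc : Tendsto (fun m => (Lcount x' (substSeq S b m {Dp j}) : ℝ) /
      pvol (substSeq S b m {Dp j})) atTop (nhds c)) :
    α ≤ c ∧ c ≤ β + δ := by
  have key : ∀ n ≥ m, α ≤ (Lcount x' (substSeq S b n {Dp j}) : ℝ) / pvol (substSeq S b n {Dp j}) ∧
      (Lcount x' (substSeq S b n {Dp j}) : ℝ) / pvol (substSeq S b n {Dp j}) ≤ β + δ := by
    intro n hn
    have hpos : 0 < volume.real (psupp (substSeq S b n {Dp j})) := by
      rw [psupp_super S n (hDp.1 j)]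
      exact (scl_isTile (Lam_pos S n b) (TilesOf_isTile hX (hDp.1 j))).vol_pos
    have hpv : pvol (substSeq S b n {Dp j}) = volume.real (psupp (substSeq S b n {Dp j})) := rfl
    rw [hpv, le_div_iff₀ hpos, div_le_iff₀ hpos]
    have heq := substSeq_add S m (n - m) {Dp j} b
    rw [Nat.add_sub_cancel' hn] at heq
    rw [heq]
    obtain ⟨hzf, x, hx, hzx⟩ := substSeq_Patches S (n - m) (single_Patches (hDp.1 j))
      (fun i => b (i + m))
    set z := substSeq S (fun i => b (i + m)) (n - m) {Dp j} with hz
    have hzX : ∀ T ∈ z, T ∈ TilesOf X := fun T hT => ⟨x, hx, hzx hT⟩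
    refine ⟨lower_count hX hnull S m b hx hzx hzf hP₀ hPt fun T hT => hα T (hzX T hT), ?_⟩
    have h1 := upper_count hX hnull S m b hx hzx subset_rfl hzf hP₀ hPt hr
      (β := β) (δ := δ) (fun T hT => hβ T (hzX T hT)) (fun T hT => hδ T (hzX T hT))
    refine le_trans (Nat.cast_le.2 ?_) h1
    refine Set.ncard_le_ncard (fun t ht => ⟨ht, ht ⟨P₀, hP₀, rfl⟩⟩) ?_
    exact (occ_finite hP₀ hPt (substSeq_Patches S m ⟨hzf, x, hx, hzx⟩ b).1).subset
      fun t ht => ht.1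
  exact ⟨ge_of_tendsto hc (eventually_atTop.2 ⟨m, fun n hn => (key n hn).1⟩),
    le_of_tendsto hc (eventually_atTop.2 ⟨m, fun n hn => (key n hn).2⟩)⟩

/-- The patch frequencies converge to their ergodic limits locally uniformly in `ā`. -/
theorem freq_locally_uniform
    {d l k : ℕ} (hd : 0 < d) (hl : 0 < l) (hk : 0 < k)
    (X : Set (Patch d)) (hX : ∀ x ∈ X, IsTiling x)
    (hXinv : TransInvariant X) (hXflc : FLC X)
    (Dp : Fin l → Set (Pt d)) (hDp : IsPrototileBasis X Dp)
    (S : Fin k → Substitution d X)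
    (D : Set (Pt d)) (hD : D ∈ TilesOf X)
    (a : ℕ → Fin k)
    (hprim : ∀ b : ℕ → Fin k, SeqPrimitive (fun i => structMat Dp (S i)) b)
    (x' : Patch d) (hx' : x' ∈ Patches (multiSpace S a D))
    (H : ℕ → Set (Pt d)) (hHb : ∀ n, Bornology.IsBounded (H n))
    (hHm : ∀ n, MeasurableSet (H n)) (hHpos : ∀ n, 0 < (volume (H n)).toReal)
    (hVH : VanHove H)
    (xb : (ℕ → Fin k) → Patch d)
    (hxb : ∀ b : ℕ → Fin k, xb b ∈ multiSpace S b D ∧ Hierarchical S b (xb b))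
    (c : (ℕ → Fin k) → ℝ)
    (hc : ∀ (b : ℕ → Fin k) (j : Fin l),
      Tendsto (fun m => (Lcount x' (substSeq S b m {Dp j}) : ℝ) / pvol (substSeq S b m {Dp j}))
        atTop (nhds (c b)))
    :
    ∃ n₀ : ℕ, 0 < n₀ ∧ ∀ ε : ℝ, 0 < ε → ∃ M : ℕ, ∀ n : ℕ, M ≤ n →
      ∀ b : ℕ → Fin k, dSigma a b < 1 / (n₀ : ℝ) →
        |(LcountIn (xb b) x' (H n) : ℝ) / (volume (H n)).toReal - c b| < ε := by
  have hFk : Nonempty (Fin k) := ⟨⟨0, hk⟩⟩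
  refine ⟨1, one_pos, fun ε hε => ?_⟩
  suffices hmain : ∃ M : ℕ, ∀ n : ℕ, M ≤ n → ∀ b ∈ (univ : Set (ℕ → Fin k)),
      |(LcountIn (xb b) x' (H n) : ℝ) / (volume (H n)).toReal - c b| < ε by
    obtain ⟨M, hM⟩ := hmain
    exact ⟨M, fun n hn b _ => hM n hn b (mem_univ b)⟩
  rcases Set.eq_empty_or_nonempty x' with hemp | ⟨P₀, hP₀⟩
  · -- the empty patch: all counts are counts of infinite sets
    have hinf : Infinite (Pt d) :=
      Infinite.of_injective (fun s : ℝ => EuclideanSpace.single (⟨0, hd⟩ : Fin d) s) (by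
        intro s t h
        have := congrArg (fun v : Pt d => v ⟨0, hd⟩) h
        simpa using this)
    have hL0 : ∀ y : Patch d, Lcount x' y = 0 := by
      intro y
      subst hemp
      simp [Lcount, patchTrans, Set.infinite_univ.ncard]
    have hLI0 : ∀ (y : Patch d) (B : Set (Pt d)), LcountIn y x' B = 0 := by
      intro y B
      subst hemp
      simp [LcountIn, patchTrans, psupp, Set.infinite_univ.ncard]
    refine ⟨0, fun n _ b _ => ?_⟩
    have hc0 : c b = 0 := by
      have := hc b ⟨0, hl⟩
      simp only [hL0, Nat.cast_zero, zero_div] at this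
      exact (tendsto_nhds_unique this tendsto_const_nhds)
    rw [hLI0, hc0]
    simpa using hε
  have hnull : ∀ T ∈ TilesOf X, volume.real (frontier T) = 0 := fun T hT =>
    frontier_null hl hk hX hDp S hT
  obtain ⟨hx'fin, x₀, hx₀, hx'x₀⟩ := hx'
  have hx't : ∀ P ∈ x', IsTile P := fun P hP => (hX x₀ hx₀.1).1.1 P (hx'x₀ hP)
  have hPt := hx't P₀ hP₀
  have hu := hPt.int_vol_pos
  obtain ⟨r, hr0, hr⟩ : ∃ r : ℝ, 0 < r ∧ ∀ p ∈ psupp x', ∀ q ∈ psupp x', dist p q ≤ r := by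
    have hb : Bornology.IsBounded (psupp x') :=
      (Bornology.isBounded_biUnion hx'fin).2 fun P hP => (hx't P hP).1.isBounded
    refine ⟨Metric.diam (psupp x') + 1, by linarith [Metric.diam_nonneg (s := psupp x')], ?_⟩
    intro p hp q hq
    linarith [Metric.dist_le_diam_of_mem hb hp hq]
  obtain ⟨ρ, hρ0, hρ⟩ := diam_bound hX hDp
  refine isCompact_univ.induction_on (p := fun s : Set (ℕ → Fin k) => ∃ M : ℕ, ∀ n : ℕ, M ≤ n →
    ∀ b ∈ s, |(LcountIn (xb b) x' (H n) : ℝ) / (volume (H n)).toReal - c b| < ε) ?_ ?_ ?_ ?_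
  · exact ⟨0, fun n _ b hb => absurd hb (notMem_empty b)⟩
  · rintro s t hst ⟨M, hM⟩
    exact ⟨M, fun n hn b hb => hM n hn b (hst hb)⟩
  · rintro s t ⟨M, hM⟩ ⟨M', hM'⟩
    refine ⟨max M M', fun n hn b hb => ?_⟩
    rcases hb with hb | hb
    · exact hM n ((le_max_left _ _).trans hn) b hb
    · exact hM' n ((le_max_right _ _).trans hn) b hb
  intro b₀ _
  set C := c b₀ with hC
  have hC0 : 0 ≤ C := ge_of_tendsto (hc b₀ ⟨0, hl⟩) (Eventually.of_forall fun m =>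
    div_nonneg (Nat.cast_nonneg _) ENNReal.toReal_nonneg)
  set e := ε / 8 with he
  have he0 : 0 < e := by positivity
  obtain ⟨m₀, hm₀⟩ := boundary_small hk hX hDp hnull S r hr0 (e * volume.real (interior P₀))
    (by positivity)
  have hev : ∀ᶠ m in atTop, ∀ j : Fin l,
      |(Lcount x' (substSeq S b₀ m {Dp j}) : ℝ) / pvol (substSeq S b₀ m {Dp j}) - C| < e := by
    rw [eventually_all]
    intro j
    have := (hc b₀ j).eventually (Metric.ball_mem_nhds _ he0)
    filter_upwards [this] with m hm
    simpa [Metric.mem_ball, Real.dist_eq] using hm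
  obtain ⟨m, hmj, hmm₀⟩ := (hev.and (eventually_ge_atTop m₀)).exists
  have hLam : 0 < Lam S b₀ m := Lam_pos S m b₀
  have hVH' := hVH (Lam S b₀ m * ρ) (by positivity)
  have hη : 0 < ε / (4 * (C + ε)) := by positivity
  obtain ⟨M, hM⟩ := eventually_atTop.1 (hVH'.eventually_lt_const hη)
  refine ⟨{b | ∀ i < m, b i = b₀ i}, ?_, M, ?_⟩
  · rw [nhdsWithin_univ]
    have hopen : IsOpen {b : ℕ → Fin k | ∀ i < m, b i = b₀ i} := by
      have : {b : ℕ → Fin k | ∀ i < m, b i = b₀ i}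
          = ⋂ i ∈ Finset.range m, (fun b : ℕ → Fin k => b i) ⁻¹' {b₀ i} := by
        ext b; simp
      rw [this]
      exact isOpen_biInter_finset fun i _ => (isOpen_discrete _).preimage (continuous_apply i)
    exact hopen.mem_nhds fun i _ => rfl
  intro n hn b hb
  have hLb : Lam S b m = Lam S b₀ m := Lam_congr S m b b₀ hb
  -- bounds on supertile frequencies
  have htile : ∀ T ∈ TilesOf X,
      max 0 (C - e) * volume.real (scl (Lam S b m) T) ≤ Lcount x' (substSeq S b m {T}) ∧
      (Lcount x' (substSeq S b m {T}) : ℝ) ≤ (C + e) * volume.real (scl (Lam S b m) T) := by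
    intro T hT
    obtain ⟨j, t, rfl⟩ := hDp.2.2 T hT
    have h1 : ({tileTrans t (Dp j)} : Patch d) = patchTrans t {Dp j} := by simp [patchTrans]
    have h2 : Lcount x' (substSeq S b m {tileTrans t (Dp j)})
        = Lcount x' (substSeq S b₀ m {Dp j}) := by
      rw [h1, substSeq_trans, Lcount_trans, substSeq_congr S m _ b b₀ hb]
    have hpv : pvol (substSeq S b₀ m {Dp j}) = volume.real (scl (Lam S b₀ m) (Dp j)) := by
      rw [← psupp_super S m (hDp.1 j) b₀]; rfl
    have hpos : 0 < volume.real (scl (Lam S b₀ m) (Dp j)) :=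
      (scl_isTile hLam (TilesOf_isTile hX (hDp.1 j))).vol_pos
    rw [h2, hLb, scl_tileTrans, vol_tileTrans]
    have h3 := abs_lt.1 (hmj j)
    rw [hpv] at h3
    have hnn : (0 : ℝ) ≤ (Lcount x' (substSeq S b₀ m {Dp j}) : ℝ) /
        volume.real (scl (Lam S b₀ m) (Dp j)) := by positivity
    constructor
    · rw [← le_div_iff₀ hpos]
      exact max_le hnn (by linarith)
    · rw [← div_le_iff₀ hpos]
      linarith
  have hδ := hm₀ m hmm₀ b
  have hα0 : 0 ≤ max 0 (C - e) := le_max_left _ _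
  have hcb := freq_bounds hX hDp hnull S m b hP₀ hPt hr (fun T hT => (htile T hT).1)
    (fun T hT => (htile T hT).2) hδ ⟨0, hl⟩ (hc b ⟨0, hl⟩)
  have hreg := region_count hX hXinv hDp hnull S m b (hxb b).1.1 (hxb b).2 hP₀ hx't hr hα0
    (by linarith) (fun T hT => (htile T hT).1) (fun T hT => (htile T hT).2) hδ hρ (hHb n)
  rw [hLb] at hreg
  have hV : 0 < volume.real (H n) := hHpos n
  have hMn : volume.real (plusR (frontier (H n)) (Lam S b₀ m * ρ)) / volume.real (H n)
    < ε / (4 * (C + ε)) := hM n hn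
  rw [← measureReal_def]
  set V := volume.real (H n) with hVdef
  set F := volume.real (plusR (frontier (H n)) (Lam S b₀ m * ρ)) with hFdef
  have hF0 : 0 ≤ F / V := div_nonneg measureReal_nonneg hV.le
  have hlo : max 0 (C - e) * (1 - F / V) ≤ (LcountIn (xb b) x' (H n) : ℝ) / V := by
    rw [le_div_iff₀ hV]
    refine le_trans (le_of_eq ?_) hreg.1
    field_simp
  have hhi : (LcountIn (xb b) x' (H n) : ℝ) / V ≤ (C + e + e) * (1 + F / V) := by
    rw [div_le_iff₀ hV]
    refine le_trans hreg.2 (le_of_eq ?_)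
    field_simp
  set η := F / V with hηdef
  have hηC : η * (C + ε) < ε / 4 := by
    rw [lt_div_iff₀ (by positivity)] at hMn
    linarith
  have hmaxC : max 0 (C - e) ≤ C := max_le hC0 (by linarith)
  have hmaxC' : C - e ≤ max 0 (C - e) := le_max_right _ _
  have hηm : max 0 (C - e) * η ≤ η * (C + ε) := by
    rw [mul_comm]
    exact mul_le_mul_of_nonneg_left (by linarith) hF0
  have hηm2 : (C + e + e) * η ≤ η * (C + ε) := by
    rw [mul_comm]
    exact mul_le_mul_of_nonneg_left (by linarith) hF0
  have h1 := hcb.1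
  have h2 := hcb.2
  rw [abs_lt]
  constructor
  · nlinarith
  · nlinarith

end
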